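/- Let n ≥ 2 and let a(t,x) satisfy Assumption (A). For every δ > 0 there exists a constant C_δ > 0 such that for all t ∈ ℝ, all x, ξ ∈ ℝⁿ and every compact interval I = [α, β] ⊂ ℝ, the Hamiltonian trajectory (x(τ;t,x,ξ), ξ(τ;t,x,ξ)) satisfies ∫_I |ξ(τ;t,x,ξ)| / ⟨x(τ;t,x,ξ)⟩^{1+δ} dτ ≤ C_δ (1 + |β − α|). -/

import Mathlib

open MeasureTheory Complex Filter

noncomputable section

abbrev V (n : ℕ) := EuclideanSpace ℝ (Fin n)

/-- Japanese bracket power `⟨x⟩^s`. -/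
def jap {n : ℕ} (x : V n) (s : ℝ) : ℝ := (1 + ‖x‖ ^ 2) ^ (s / 2)

/-- Assumption (A) on the magnetic vector potential. -/
def AssumptionA {n : ℕ} (a : ℝ → V n → V n) (ρ : ℝ) : Prop :=
  ContDiff ℝ (⊤ : ℕ∞) (fun p : ℝ × V n => a p.1 p.2) ∧
  ∀ k : ℕ, ∃ C : ℝ, 0 < C ∧ ∀ t : ℝ, ∀ x : V n,
    ‖iteratedFDeriv ℝ k (a t) x‖ ≤ C * jap x (ρ - k)

/-- The Hamiltonian flow of `h(t,x,ξ) = |ξ - a(t,x)|²/2` with data `(x, ξ)` at time `t₀`. -/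
def IsHamFlow {n : ℕ} (a : ℝ → V n → V n) (t₀ : ℝ) (x ξ : V n) (X Ξ : ℝ → V n) : Prop :=
  X t₀ = x ∧ Ξ t₀ = ξ ∧ ∀ s : ℝ,
    HasDerivAt X (Ξ s - a s (X s)) s ∧
    HasDerivAt Ξ (ContinuousLinearMap.adjoint (fderiv ℝ (a s) (X s)) (Ξ s - a s (X s))) s

/-- Conic neighborhood of `ξ₀`. -/
def IsConicNbhd {n : ℕ} (Γ : Set (V n)) (ξ₀ : V n) : Prop :=
  IsOpen Γ ∧ ξ₀ ∈ Γ ∧ ∀ ξ ∈ Γ, ∀ c : ℝ, 0 < c → c • ξ ∈ Γ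

lemma jap_le_sqrt {n : ℕ} (x : V n) {s : ℝ} (hs : s ≤ 1) : jap x s ≤ √(1 + ‖x‖ ^ 2) := by
  rw [Real.sqrt_eq_rpow]
  exact Real.rpow_le_rpow_of_exponent_le (by nlinarith [sq_nonneg ‖x‖]) (by linarith)

lemma jap_le_one {n : ℕ} (x : V n) {s : ℝ} (hs : s ≤ 0) : jap x s ≤ 1 :=
  Real.rpow_le_one_of_one_le_of_nonpos (by nlinarith [sq_nonneg ‖x‖]) (by linarith)

lemma jap_pos {n : ℕ} (x : V n) (s : ℝ) : 0 < jap x s :=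
  Real.rpow_pos_of_pos (by positivity) _

lemma jap_one_add {n : ℕ} (x : V n) (s : ℝ) :
    jap x (1 + s) = √(1 + ‖x‖ ^ 2) / jap x (-s) := by
  have h : (0 : ℝ) < 1 + ‖x‖ ^ 2 := by positivity
  rw [jap, jap, Real.sqrt_eq_rpow, ← Real.rpow_sub h]
  congr 1
  ring

/-- A potential satisfying Assumption (A) grows at most linearly and has a bounded
spatial derivative, uniformly in time. -/
lemma AssumptionA.exists_linear_bound {n : ℕ} {a : ℝ → V n → V n} {ρ : ℝ}
    (hA : AssumptionA a ρ) (hρ : ρ < 1) :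
    ∃ A : ℝ, 0 ≤ A ∧ ∀ t x, ‖a t x‖ ≤ A * √(1 + ‖x‖ ^ 2) ∧ ‖fderiv ℝ (a t) x‖ ≤ A := by
  obtain ⟨C₀, hC₀, h₀⟩ := hA.2 0
  obtain ⟨C₁, hC₁, h₁⟩ := hA.2 1
  refine ⟨max C₀ C₁, hC₀.le.trans (le_max_left _ _), fun t x => ⟨?_, ?_⟩⟩
  · have h := h₀ t x
    rw [norm_iteratedFDeriv_zero] at h
    refine h.trans (mul_le_mul (le_max_left _ _) (jap_le_sqrt x ?_) (jap_pos _ _).le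
      (hC₀.le.trans (le_max_left _ _)))
    simpa using hρ.le
  · have h := h₁ t x
    rw [norm_iteratedFDeriv_one] at h
    have hj : jap x (ρ - (1 : ℕ)) ≤ 1 := jap_le_one x (by push_cast; linarith)
    calc _ ≤ C₁ * jap x (ρ - (1 : ℕ)) := h
      _ ≤ C₁ * 1 := by gcongr
      _ ≤ _ := by simp

/-- The escape function `⟨x, ξ⟩ (2 - ⟨x⟩^{-δ}) / (⟨x⟩ √(⟨x⟩² + |ξ|²))`. -/
def escapeFun {n : ℕ} (δ : ℝ) (x ξ : V n) : ℝ :=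
  inner ℝ x ξ * (2 - jap x (-δ)) / (√(1 + ‖x‖ ^ 2) * √(1 + ‖x‖ ^ 2 + ‖ξ‖ ^ 2))

lemma abs_escapeFun_le {n : ℕ} {δ : ℝ} (hδ : 0 ≤ δ) (x ξ : V n) : |escapeFun δ x ξ| ≤ 2 := by
  have hx : ‖x‖ ≤ √(1 + ‖x‖ ^ 2) := Real.le_sqrt_of_sq_le (by linarith)
  have hξ : ‖ξ‖ ≤ √(1 + ‖x‖ ^ 2 + ‖ξ‖ ^ 2) :=
    Real.le_sqrt_of_sq_le (by nlinarith [sq_nonneg ‖x‖])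
  have hw : |2 - jap x (-δ)| ≤ 2 := by
    rw [abs_le]
    constructor <;> linarith [jap_pos x (-δ), jap_le_one x (neg_nonpos.2 hδ)]
  have hp : 0 < √(1 + ‖x‖ ^ 2) * √(1 + ‖x‖ ^ 2 + ‖ξ‖ ^ 2) := by positivity
  rw [escapeFun, abs_div, abs_of_pos hp, div_le_iff₀ hp, abs_mul]
  calc _ ≤ (‖x‖ * ‖ξ‖) * 2 := by
        gcongr
        exact abs_real_inner_le_norm x ξ
    _ ≤ (√(1 + ‖x‖ ^ 2) * √(1 + ‖x‖ ^ 2 + ‖ξ‖ ^ 2)) * 2 := by gcongr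
    _ = _ := mul_comm _ _

lemma hasDerivAt_escapeFun {n : ℕ} (δ : ℝ) {X Ξ : ℝ → V n} {v b : V n} {τ : ℝ}
    (hX : HasDerivAt X v τ) (hΞ : HasDerivAt Ξ b τ) {R L : ℝ}
    (hR : R = √(1 + ‖X τ‖ ^ 2)) (hL : L = √(1 + ‖X τ‖ ^ 2 + ‖Ξ τ‖ ^ 2)) :
    HasDerivAt (fun s => escapeFun δ (X s) (Ξ s))
      ((inner ℝ v (Ξ τ) + inner ℝ (X τ) b) * (2 - jap (X τ) (-δ)) / (R * L)
        + δ * jap (X τ) (-δ) * inner ℝ (X τ) (Ξ τ) * inner ℝ (X τ) v / (R ^ 3 * L)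
        - inner ℝ (X τ) (Ξ τ) * (2 - jap (X τ) (-δ)) * inner ℝ (X τ) v / (R ^ 3 * L)
        - inner ℝ (X τ) (Ξ τ) * (2 - jap (X τ) (-δ)) *
          (inner ℝ (X τ) v + inner ℝ (Ξ τ) b) / (R * L ^ 3)) τ := by
  have hu : 0 < 1 + ‖X τ‖ ^ 2 := by positivity
  have hl : 0 < 1 + ‖X τ‖ ^ 2 + ‖Ξ τ‖ ^ 2 := by positivity
  have hRpos : 0 < R := hR ▸ Real.sqrt_pos.2 hu
  have hLpos : 0 < L := hL ▸ Real.sqrt_pos.2 hl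
  have hR2 : 1 + ‖X τ‖ ^ 2 = R ^ 2 := by rw [hR, Real.sq_sqrt hu.le]
  have du : HasDerivAt (fun s => 1 + ‖X s‖ ^ 2) (2 * inner ℝ (X τ) v) τ :=
    hX.norm_sq.const_add 1
  have dl : HasDerivAt (fun s => 1 + ‖X s‖ ^ 2 + ‖Ξ s‖ ^ 2)
      (2 * inner ℝ (X τ) v + 2 * inner ℝ (Ξ τ) b) τ := du.add hΞ.norm_sq
  have dR := du.sqrt hu.ne'
  have dL := dl.sqrt hl.ne'
  have dD : HasDerivAt (fun s => jap (X s) (-δ))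
      (2 * inner ℝ (X τ) v * (-δ / 2) * (1 + ‖X τ‖ ^ 2) ^ (-δ / 2 - 1)) τ :=
    du.rpow_const (Or.inl hu.ne')
  have hD : (1 + ‖X τ‖ ^ 2) ^ (-δ / 2 - 1) = jap (X τ) (-δ) / R ^ 2 := by
    rw [Real.rpow_sub_one hu.ne', jap, hR2]
  rw [hD] at dD
  have ds := hX.inner ℝ hΞ
  have hne : √(1 + ‖X τ‖ ^ 2) * √(1 + ‖X τ‖ ^ 2 + ‖Ξ τ‖ ^ 2) ≠ 0 := by
    rw [← hR, ← hL]; positivity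
  have h := (ds.mul (dD.const_sub 2)).div (dR.mul dL) hne
  refine h.congr_deriv ?_
  simp only [Pi.mul_apply, ← hR, ← hL]
  field_simp
  ring

/-- The pointwise inequality behind the positivity of the derivative of the escape function. -/
lemma escape_deriv_lower_bound {δ c A R L y D s e₁ e₂ e₃ k : ℝ}
    (hδ : 0 ≤ δ) (hc0 : 0 ≤ c) (hc1 : c ≤ 1) (hcδ : c ≤ δ) (hA : 0 ≤ A) (hR : 1 ≤ R)
    (hL : 0 < L) (hLsq : L ^ 2 = R ^ 2 + y ^ 2) (hy : 0 ≤ y) (hD0 : 0 < D) (hD1 : D ≤ 1)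
    (hs : |s| ≤ R * y) (h₁ : |e₁| ≤ A * R * y) (h₂ : |e₂| ≤ R * (A * (y + A * R)))
    (h₃ : |e₃| ≤ A * R ^ 2) (hk : |k| ≤ y * (A * (y + A * R))) :
    c * (y / (R / D)) - (1 + 4 * A + 2 * A * (1 + A) + δ * A + 2 * (1 + A) ^ 2) ≤
      ((y ^ 2 - e₁) + e₂) * (2 - D) / (R * L) + δ * D * s * (s - e₃) / (R ^ 3 * L)
        - s * (2 - D) * (s - e₃) / (R ^ 3 * L)
        - s * (2 - D) * ((s - e₃) + k) / (R * L ^ 3) := by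
  have hR0 : 0 < R := by linarith
  have hRL : R ≤ L := abs_le_of_sq_le_sq' (by nlinarith) hL.le |>.2
  have hyL : y ≤ L := abs_le_of_sq_le_sq' (by nlinarith) hL.le |>.2
  have hw : |2 - D| ≤ 2 := by rw [abs_le]; constructor <;> linarith
  have hyAR : y + A * R ≤ (1 + A) * L := by nlinarith
  have hsRL : |s| ≤ R * L := hs.trans (by gcongr)
  have b₁ : |e₁ * (2 - D) / (R * L)| ≤ 2 * A := by
    rw [abs_div, abs_mul, abs_of_pos (by positivity : 0 < R * L), div_le_iff₀ (by positivity)]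
    calc _ ≤ (A * R * L) * 2 := by
          gcongr
          exact h₁.trans (by gcongr)
      _ = _ := by ring
  have b₂ : |e₂ * (2 - D) / (R * L)| ≤ 2 * A * (1 + A) := by
    rw [abs_div, abs_mul, abs_of_pos (by positivity : 0 < R * L), div_le_iff₀ (by positivity)]
    calc _ ≤ (R * (A * ((1 + A) * L))) * 2 := by
          gcongr
          exact h₂.trans (by gcongr)
      _ = _ := by ring
  have b₃ : |δ * D * s * e₃ / (R ^ 3 * L)| ≤ δ * A := by
    rw [abs_div, abs_mul, abs_mul, abs_mul, abs_of_pos (by positivity : 0 < R ^ 3 * L),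
      div_le_iff₀ (by positivity), abs_of_nonneg hδ, abs_of_pos hD0]
    calc _ ≤ δ * 1 * (R * L) * (A * R ^ 2) := by gcongr
      _ = _ := by ring
  have b₄ : |s * (2 - D) * e₃ / (R ^ 3 * L)| ≤ 2 * A := by
    rw [abs_div, abs_mul, abs_mul, abs_of_pos (by positivity : 0 < R ^ 3 * L),
      div_le_iff₀ (by positivity)]
    calc _ ≤ (R * L) * 2 * (A * R ^ 2) := by gcongr
      _ = _ := by ring
  have b₅ : |s * (2 - D) * ((s - e₃) + k) / (R * L ^ 3)| ≤ 2 * (1 + A) ^ 2 := by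
    rw [abs_div, abs_mul, abs_mul, abs_of_pos (by positivity : 0 < R * L ^ 3),
      div_le_iff₀ (by positivity)]
    have hm : |(s - e₃) + k| ≤ (1 + A) ^ 2 * L ^ 2 := by
      calc _ ≤ |s| + |e₃| + |k| := (abs_add_le _ _).trans (by gcongr; exact abs_sub _ _)
        _ ≤ L * L + A * L ^ 2 + L * (A * ((1 + A) * L)) := by
          gcongr
          · exact hsRL.trans (by gcongr)
          · exact h₃.trans (by gcongr)
          · exact hk.trans (by gcongr)
        _ = _ := by ring
    calc _ ≤ (R * L) * 2 * ((1 + A) ^ 2 * L ^ 2) := by gcongr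
      _ = _ := by ring
  have hq : (s / R) ^ 2 ≤ y ^ 2 := by
    apply sq_le_sq'
    · rw [le_div_iff₀ hR0]; linarith [(abs_le.1 hs).1]
    · rw [div_le_iff₀ hR0]; linarith [(abs_le.1 hs).2]
  have hq0 := sq_nonneg (s / R)
  have hmain : c * D * y ^ 2 ≤ (2 - D) * (y ^ 2 - (s / R) ^ 2) + δ * D * (s / R) ^ 2 := by
    have hcD : c * D ≤ 2 - D := by nlinarith
    have : c * D ≤ δ * D := by gcongr
    nlinarith [mul_le_mul_of_nonneg_right hcD (sub_nonneg.2 hq),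
      mul_le_mul_of_nonneg_right this hq0]
  have hyy : y - R ≤ y ^ 2 / L := by
    rw [le_div_iff₀ hL]
    nlinarith
  have hlow : c * (y / (R / D)) - 1 ≤ c * D * y ^ 2 / (R * L) := by
    have hcD1 : c * D ≤ 1 := mul_le_one₀ hc1 hD0.le hD1
    calc c * (y / (R / D)) - 1 ≤ c * (y / (R / D)) - c * D := by linarith
      _ = c * D * (y - R) / R := by field_simp
      _ ≤ c * D * (y ^ 2 / L) / R := by gcongr
      _ = _ := by field_simp
  have hmain' := div_le_div_of_nonneg_right hmain (by positivity : 0 ≤ R * L)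
  have hsplit : ((y ^ 2 - e₁) + e₂) * (2 - D) / (R * L) + δ * D * s * (s - e₃) / (R ^ 3 * L)
        - s * (2 - D) * (s - e₃) / (R ^ 3 * L)
        - s * (2 - D) * ((s - e₃) + k) / (R * L ^ 3) =
      ((2 - D) * (y ^ 2 - (s / R) ^ 2) + δ * D * (s / R) ^ 2) / (R * L)
        - e₁ * (2 - D) / (R * L) + e₂ * (2 - D) / (R * L)
        - δ * D * s * e₃ / (R ^ 3 * L) + s * (2 - D) * e₃ / (R ^ 3 * L)
        - s * (2 - D) * ((s - e₃) + k) / (R * L ^ 3) := by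
    field_simp
    ring
  rw [hsplit]
  linarith [(abs_le.1 b₁).2, (abs_le.1 b₂).1, (abs_le.1 b₃).2, (abs_le.1 b₄).1, (abs_le.1 b₅).2]

/-- Along a Hamiltonian trajectory the derivative of the escape function controls
`|ξ| / ⟨x⟩^{1+δ}` up to a constant. -/
lemma IsHamFlow.exists_hasDerivAt_escapeFun {n : ℕ} {a : ℝ → V n → V n} {A : ℝ} (hA : 0 ≤ A)
    (ha : ∀ t x, ‖a t x‖ ≤ A * √(1 + ‖x‖ ^ 2) ∧ ‖fderiv ℝ (a t) x‖ ≤ A)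
    {δ : ℝ} (hδ : 0 ≤ δ) {t : ℝ} {x ξ : V n} {X Ξ : ℝ → V n} (h : IsHamFlow a t x ξ X Ξ)
    (τ : ℝ) :
    ∃ F' : ℝ, HasDerivAt (fun s => escapeFun δ (X s) (Ξ s)) F' τ ∧
      min 1 δ * (‖Ξ τ‖ / jap (X τ) (1 + δ)) -
        (1 + 4 * A + 2 * A * (1 + A) + δ * A + 2 * (1 + A) ^ 2) ≤ F' := by
  obtain ⟨hX, hΞ⟩ := h.2.2 τ
  obtain ⟨ha₀, ha₁⟩ := ha τ (X τ)
  refine ⟨_, hasDerivAt_escapeFun δ hX hΞ rfl rfl, ?_⟩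
  set R := √(1 + ‖X τ‖ ^ 2)
  set L := √(1 + ‖X τ‖ ^ 2 + ‖Ξ τ‖ ^ 2)
  set T := fderiv ℝ (a τ) (X τ)
  have hRsq : R ^ 2 = 1 + ‖X τ‖ ^ 2 := Real.sq_sqrt (by positivity)
  have hLsq : L ^ 2 = 1 + ‖X τ‖ ^ 2 + ‖Ξ τ‖ ^ 2 := Real.sq_sqrt (by positivity)
  have hXR : ‖X τ‖ ≤ R := Real.le_sqrt_of_sq_le (by linarith)
  have hR0 : 0 ≤ R := Real.sqrt_nonneg _
  have hv : ‖Ξ τ - a τ (X τ)‖ ≤ ‖Ξ τ‖ + A * R := (norm_sub_le _ _).trans (by gcongr)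
  have hb : ‖ContinuousLinearMap.adjoint T (Ξ τ - a τ (X τ))‖ ≤ A * (‖Ξ τ‖ + A * R) := by
    refine (ContinuousLinearMap.le_opNorm _ _).trans ?_
    rw [LinearIsometryEquiv.norm_map]
    gcongr
  have i₁ : inner ℝ (Ξ τ - a τ (X τ)) (Ξ τ) = ‖Ξ τ‖ ^ 2 - inner ℝ (a τ (X τ)) (Ξ τ) := by
    rw [inner_sub_left, real_inner_self_eq_norm_sq]
  have i₂ : inner ℝ (X τ) (Ξ τ - a τ (X τ)) =
      inner ℝ (X τ) (Ξ τ) - inner ℝ (X τ) (a τ (X τ)) := inner_sub_right _ _ _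
  rw [i₁, i₂, jap_one_add]
  refine escape_deriv_lower_bound hδ (le_min zero_le_one hδ) (min_le_left _ _) (min_le_right _ _)
    hA (Real.one_le_sqrt.2 (by nlinarith [sq_nonneg ‖X τ‖])) (Real.sqrt_pos.2 (by positivity))
    (by rw [hRsq, hLsq]) (norm_nonneg _) (jap_pos _ _) (jap_le_one _ (neg_nonpos.2 hδ))
    ?_ ?_ ?_ ?_ ?_
  · exact (abs_real_inner_le_norm _ _).trans (by gcongr)
  · exact (abs_real_inner_le_norm _ _).trans (by gcongr)
  · exact (abs_real_inner_le_norm _ _).trans (by gcongr)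
  · calc _ ≤ ‖X τ‖ * ‖a τ (X τ)‖ := abs_real_inner_le_norm _ _
      _ ≤ R * (A * R) := by gcongr
      _ = _ := by ring
  · exact (abs_real_inner_le_norm _ _).trans (by gcongr)

/-- **Lemma A.2.** Uniform integral estimate along the Hamiltonian flow:
`∫_I |ξ(τ)| / ⟨x(τ)⟩^{1+δ} dτ ≤ C_δ (1 + |β - α|)`. -/
theorem trajectory_integral_estimate
    (n : ℕ) (hn : 2 ≤ n) (a : ℝ → V n → V n) (ρ : ℝ) (hρ : ρ < 1)
    (hA : AssumptionA a ρ) (δ : ℝ) (hδ : 0 < δ) :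
    ∃ C : ℝ, 0 < C ∧ ∀ t : ℝ, ∀ x ξ : V n, ∀ α β : ℝ, α ≤ β →
      ∀ X Ξ : ℝ → V n, IsHamFlow a t x ξ X Ξ →
        (∫ τ in α..β, ‖Ξ τ‖ / jap (X τ) (1 + δ)) ≤ C * (1 + |β - α|) := by
  obtain ⟨A, hA0, hAb⟩ := hA.exists_linear_bound hρ
  set K := 1 + 4 * A + 2 * A * (1 + A) + δ * A + 2 * (1 + A) ^ 2
  set c := min 1 δ
  have hc : 0 < c := lt_min one_pos hδ
  have hK0 : 0 ≤ K := by positivity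
  refine ⟨(4 + K) / c, by positivity, fun t x ξ α β hαβ X Ξ h => ?_⟩
  choose F' hF' hle using h.exists_hasDerivAt_escapeFun hA0 hAb hδ.le
  have hXc : Continuous X := continuous_iff_continuousAt.2 fun s => (h.2.2 s).1.continuousAt
  have hΞc : Continuous Ξ := continuous_iff_continuousAt.2 fun s => (h.2.2 s).2.continuousAt
  have hg : Continuous fun τ => ‖Ξ τ‖ / jap (X τ) (1 + δ) := by
    refine hΞc.norm.div ?_ fun τ => (jap_pos _ _).ne'
    exact (continuous_const.add (hXc.norm.pow 2)).rpow_const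
      fun τ => Or.inl (show 1 + ‖X τ‖ ^ 2 ≠ 0 by positivity)
  have hcg : Continuous fun τ => c * (‖Ξ τ‖ / jap (X τ) (1 + δ)) := continuous_const.mul hg
  have key := intervalIntegral.integral_le_sub_of_hasDeriv_right_of_le hαβ
    (fun τ _ => (hF' τ).continuousAt.continuousWithinAt)
    (fun τ _ => (hF' τ).hasDerivWithinAt)
    (φ := fun τ => c * (‖Ξ τ‖ / jap (X τ) (1 + δ)) - K)
    ((hcg.sub continuous_const).continuousOn.integrableOn_Icc)
    (fun τ _ => hle τ)
  rw [intervalIntegral.integral_sub (hcg.intervalIntegrable _ _)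
    intervalIntegrable_const, intervalIntegral.integral_const_mul,
    intervalIntegral.integral_const, smul_eq_mul] at key
  have hα := (abs_le.1 (abs_escapeFun_le hδ.le (X α) (Ξ α))).1
  have hβ := (abs_le.1 (abs_escapeFun_le hδ.le (X β) (Ξ β))).2
  rw [abs_of_nonneg (sub_nonneg.2 hαβ), div_mul_eq_mul_div, le_div_iff₀ hc]
  nlinarith [mul_nonneg hK0 (sub_nonneg.2 hαβ)]

end
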